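/- Let f : X → Y be a Lipschitz map from a geodesic metric space X to a metric space Y and let n ∈ ℕ₀. If for every r > 0 the collection 𝕐_r := {f⁻¹(B(y, r))}_{y∈Y} of preimages of open r-balls satisfies asdim(𝕐_r) ≤ n uniformly, then asdim X ≤ asdim Y + n. -/

import Mathlib

open Set Filter Pointwise

section Defs

variable {X Y G H : Type*}

/-- `d` is a metric on `X`. -/
def IsMetric (d : X → X → ℝ) : Prop :=
  (∀ x y, 0 ≤ d x y) ∧ (∀ x y, d x y = 0 ↔ x = y) ∧ (∀ x y, d x y = d y x) ∧
    (∀ x y z, d x z ≤ d x y + d y z)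

/-- `d` is a left-invariant metric on the group `G`. -/
def IsLeftInvariant [Group G] (d : G → G → ℝ) : Prop :=
  ∀ g x y : G, d (g * x) (g * y) = d x y

/-- `d` is proper: closed balls are compact, where a countable group is regarded as a
discrete topological space. -/
def IsProperMetric (d : G → G → ℝ) : Prop :=
  ∀ (x : G) (r : ℝ), @IsCompact G ⊥ {y | d x y ≤ r}

/-- The (left) defect set `D(f) = {f(y)⁻¹ f(x)⁻¹ f(xy) | x y ∈ G}` of a map between groups. -/
def defectSet [Group G] [Group H] (f : G → H) : Set H :=
  {h | ∃ x y : G, h = (f y)⁻¹ * (f x)⁻¹ * f (x * y)}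

/-- `f` is a quasimorphism if its defect set is finite. -/
def IsQuasimorphism [Group G] [Group H] (f : G → H) : Prop :=
  (defectSet f).Finite

/-- `f` is symmetric: `f(a⁻¹) = f(a)⁻¹`. -/
def IsSymmetricMap [Group G] [Group H] (f : G → H) : Prop :=
  ∀ a : G, f a⁻¹ = (f a)⁻¹

/-- `f` is unital: `f(e) = e`. -/
def IsUnitalMap [Group G] [Group H] (f : G → H) : Prop :=
  f 1 = 1

/-- `Λ` is an approximate subgroup of `G`: symmetric, unital and `Λ² ⊆ ΛF` for a finite `F`. -/
def IsApproxSubgroup [Group G] (Λ : Set G) : Prop :=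
  Λ⁻¹ = Λ ∧ (1 : G) ∈ Λ ∧ ∃ F : Set G, F.Finite ∧ Λ * Λ ⊆ Λ * F

/-- The subset `s` of `X` has asymptotic dimension at most `n`, with respect to the
(restriction of the) metric `d`: for every `R > 0` there is a cover of `s` by subsets of `s`,
uniformly bounded by some `D > 0`, splitting into `n + 1` `R`-disjoint families. -/
def ASDimLE (d : X → X → ℝ) (s : Set X) (n : ℕ) : Prop :=
  ∀ R : ℝ, 0 < R → ∃ D : ℝ, 0 < D ∧ ∃ 𝒰 : Fin (n + 1) → Set (Set X),
    (∀ i, ∀ u ∈ 𝒰 i, u ⊆ s) ∧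
    (s ⊆ ⋃ i, ⋃₀ 𝒰 i) ∧
    (∀ i, ∀ u ∈ 𝒰 i, ∀ x ∈ u, ∀ y ∈ u, d x y ≤ D) ∧
    (∀ i, ∀ u ∈ 𝒰 i, ∀ v ∈ 𝒰 i, u ≠ v → ∀ x ∈ u, ∀ y ∈ v, R ≤ d x y)

/-- The asymptotic dimension of the subset `s` of `X` with respect to the metric `d`,
as an element of `ℕ∞` (`⊤` means infinite asymptotic dimension). -/
noncomputable def asdim (d : X → X → ℝ) (s : Set X) : ℕ∞ :=
  sInf ((fun n : ℕ => (n : ℕ∞)) '' {n | ASDimLE d s n})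

/-- A family `𝒴` of subsets of `X` has asymptotic dimension uniformly bounded by `n`: for
every `R > 0` there is a common `D > 0` such that every member admits a `D`-bounded cover
splitting into `n + 1` `R`-disjoint families. -/
def ASDimUnifLE {ι : Type*} (d : X → X → ℝ) (𝒴 : ι → Set X) (n : ℕ) : Prop :=
  ∀ R : ℝ, 0 < R → ∃ D : ℝ, 0 < D ∧ ∀ α : ι, ∃ 𝒰 : Fin (n + 1) → Set (Set X),
    (∀ i, ∀ u ∈ 𝒰 i, u ⊆ 𝒴 α) ∧
    (𝒴 α ⊆ ⋃ i, ⋃₀ 𝒰 i) ∧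
    (∀ i, ∀ u ∈ 𝒰 i, ∀ x ∈ u, ∀ y ∈ u, d x y ≤ D) ∧
    (∀ i, ∀ u ∈ 𝒰 i, ∀ v ∈ 𝒰 i, u ≠ v → ∀ x ∈ u, ∀ y ∈ v, R ≤ d x y)

/-- `f` is coarsely Lipschitz on the subset `s`. -/
def IsCoarselyLipschitzOn (dX : X → X → ℝ) (dY : Y → Y → ℝ) (s : Set X) (f : X → Y) : Prop :=
  ∃ Φ : ℝ → ℝ, (∀ t, 0 ≤ t → 0 ≤ Φ t) ∧ MonotoneOn Φ (Ici (0 : ℝ)) ∧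
    Tendsto Φ atTop atTop ∧ ∀ x ∈ s, ∀ x' ∈ s, dY (f x) (f x') ≤ Φ (dX x x')

/-- `f` is coarsely Lipschitz: `d_Y(f x, f x') ≤ Φ₊(d_X(x, x'))` for a non-decreasing
`Φ₊ : [0,∞) → [0,∞)` tending to `∞`. -/
def IsCoarselyLipschitz (dX : X → X → ℝ) (dY : Y → Y → ℝ) (f : X → Y) : Prop :=
  ∃ Φ : ℝ → ℝ, (∀ t, 0 ≤ t → 0 ≤ Φ t) ∧ MonotoneOn Φ (Ici (0 : ℝ)) ∧
    Tendsto Φ atTop atTop ∧ ∀ x x' : X, dY (f x) (f x') ≤ Φ (dX x x')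

/-- `f` is a coarse equivalence from `(s, dX)` to `(t, dY)`: a coarse embedding whose image
is coarsely dense in `t`. -/
def IsCoarseEquivOn (dX : X → X → ℝ) (dY : Y → Y → ℝ) (s : Set X) (t : Set Y) (f : X → Y) :
    Prop :=
  MapsTo f s t ∧
  (∃ Φm Φp : ℝ → ℝ, (∀ u, 0 ≤ u → 0 ≤ Φm u) ∧ (∀ u, 0 ≤ u → 0 ≤ Φp u) ∧
    MonotoneOn Φm (Ici (0 : ℝ)) ∧ MonotoneOn Φp (Ici (0 : ℝ)) ∧
    Tendsto Φm atTop atTop ∧ Tendsto Φp atTop atTop ∧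
    ∀ x ∈ s, ∀ x' ∈ s,
      Φm (dX x x') ≤ dY (f x) (f x') ∧ dY (f x) (f x') ≤ Φp (dX x x')) ∧
  ∃ L : ℝ, 0 < L ∧ ∀ y ∈ t, ∃ x ∈ s, dY y (f x) < L

/-- `f : (X, dX) → (Y, dY)` is a coarse equivalence. -/
def IsCoarseEquiv (dX : X → X → ℝ) (dY : Y → Y → ℝ) (f : X → Y) : Prop :=
  IsCoarseEquivOn dX dY univ univ f

end Defs
section Helpers

/-- One step of an `r`-chain inside `A`. -/
def ChStep {X : Type*} (d : X → X → ℝ) (A : Set X) (r : ℝ) (x y : X) : Prop :=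
  x ∈ A ∧ y ∈ A ∧ d x y < r

/-- `r`-components of `A` are `D`-bounded. -/
def ChBdd {X : Type*} (d : X → X → ℝ) (A : Set X) (r D : ℝ) : Prop :=
  ∀ x y, Relation.ReflTransGen (ChStep d A r) x y → d x y ≤ D

open Relation

theorem ChBdd.mono {X : Type*} {d : X → X → ℝ} {A A' : Set X} {r r' D D' : ℝ}
    (h : ChBdd d A r D) (hA : A' ⊆ A) (hr : r' ≤ r) (hD : D ≤ D') : ChBdd d A' r' D' := by
  intro x y hxy
  refine (h x y (ReflTransGen.mono ?_ _ _ hxy)).trans hD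
  rintro a b ⟨h1, h2, h3⟩
  exact ⟨hA h1, hA h2, h3.trans_le hr⟩

theorem chBdd_sUnion {X : Type*} {d : X → X → ℝ} (hd : IsMetric d) {U : Set (Set X)} {R D : ℝ}
    (hD : 0 < D) (hb : ∀ u ∈ U, ∀ x ∈ u, ∀ y ∈ u, d x y ≤ D)
    (hdis : ∀ u ∈ U, ∀ v ∈ U, u ≠ v → ∀ x ∈ u, ∀ y ∈ v, R ≤ d x y) :
    ChBdd d (⋃₀ U) R D := by
  intro x y hxy
  rcases ReflTransGen.cases_head hxy with rfl | ⟨w, ⟨⟨u, hu, hxu⟩, -, -⟩, -⟩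
  · rw [(hd.2.1 x x).2 rfl]; exact hD.le
  · suffices y ∈ u from hb u hu x hxu y this
    induction hxy with
    | refl => exact hxu
    | tail _ h ih =>
      obtain ⟨-, ⟨v, hv, hyv⟩, hlt⟩ := h
      by_cases huv : u = v
      · exact huv ▸ hyv
      · exact absurd (hdis u hu v hv huv _ ih _ hyv) (not_le.2 hlt)

theorem chBdd_union {X : Type*} {d : X → X → ℝ} (hd : IsMetric d) {b c : Set X}
    {r D1 D2 : ℝ} (hr : 0 < r) (hb : ChBdd d b r D1) (hc : ChBdd d c (D1 + 3 * r) D2) :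
    ChBdd d (b ∪ c) r (2 * D1 + 2 * r + D2) := by
  obtain ⟨hnn, hz, hsymm, htri⟩ := hd
  intro x y hxy
  have hD1 : 0 ≤ D1 := by
    have := hb x x .refl
    rwa [(hz x x).2 rfl] at this
  have hD2 : 0 ≤ D2 := by
    have := hc x x .refl
    rwa [(hz x x).2 rfl] at this
  have key : ReflTransGen (ChStep d b r) x y ∨ ∃ c1 c2, d x c1 ≤ D1 + r ∧ c2 ∈ c ∧
      ReflTransGen (ChStep d c (D1 + 3 * r)) c1 c2 ∧
      (y = c2 ∨ ∃ y', d c2 y' < r ∧ ReflTransGen (ChStep d b r) y' y) := by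
    induction hxy with
    | refl => exact Or.inl .refl
    | @tail y z _ h ih =>
      obtain ⟨hy, hzz, hlt⟩ := h
      rcases hzz with hzb | hzc
      · rcases ih with ih | ⟨c1, c2, h1, h2, h3, h4⟩
        · rcases hy with hyb | hyc
          · exact Or.inl (ih.tail ⟨hyb, hzb, hlt⟩)
          · exact Or.inr ⟨y, y, by linarith [hb _ _ ih], hyc, .refl, Or.inr ⟨z, hlt, .refl⟩⟩
        · right
          rcases h4 with rfl | ⟨y', h5, h6⟩
          · exact ⟨c1, y, h1, h2, h3, Or.inr ⟨z, hlt, .refl⟩⟩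
          · rcases hy with hyb | hyc
            · exact ⟨c1, c2, h1, h2, h3, Or.inr ⟨y', h5, h6.tail ⟨hyb, hzb, hlt⟩⟩⟩
            · refine ⟨c1, y, h1, hyc, h3.tail ⟨h2, hyc, ?_⟩, Or.inr ⟨z, hlt, .refl⟩⟩
              linarith [htri c2 y' y, hb _ _ h6]
      · right
        rcases ih with ih | ⟨c1, c2, h1, h2, h3, h4⟩
        · exact ⟨z, z, by linarith [hb _ _ ih, htri x y z], hzc, .refl, Or.inl rfl⟩
        · refine ⟨c1, z, h1, hzc, h3.tail ⟨h2, hzc, ?_⟩, Or.inl rfl⟩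
          rcases h4 with rfl | ⟨y', h5, h6⟩
          · linarith
          · linarith [htri c2 y' y, htri c2 y z, hb _ _ h6]
  rcases key with h | ⟨c1, c2, h1, h2, h3, h4⟩
  · linarith [hb _ _ h]
  · have h5 := hc _ _ h3
    rcases h4 with rfl | ⟨y', h6, h7⟩
    · linarith [htri x c1 y]
    · linarith [htri x c1 c2, htri x c2 y, htri c2 y' y, hb _ _ h7]

/-- Covering of `S` by `n+1` sets, nice over `R`-balls. -/
def QCov {X Y : Type*} (dX : X → X → ℝ) (dY : Y → Y → ℝ) (f : X → Y) (n : ℕ) (R : ℝ)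
    (S : Set X) : Prop :=
  ∀ r : ℝ, 0 < r → ∃ D : ℝ, ∃ B : ℕ → Set X, (∀ x ∈ S, ∃ i < n + 1, x ∈ B i) ∧
    ∀ i < n + 1, ∀ y : Y, ChBdd dX (B i ∩ {x | dY y (f x) ≤ R}) r D

theorem QCov.union {X Y : Type*} {dX : X → X → ℝ} {dY : Y → Y → ℝ} (hX : IsMetric dX)
    {f : X → Y} {n : ℕ} {R : ℝ} {S T : Set X} (hS : QCov dX dY f n R S)
    (hT : QCov dX dY f n R T) : QCov dX dY f n R (S ∪ T) := by
  intro r hr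
  obtain ⟨D1, B, hB1, hB2⟩ := hS r hr
  obtain ⟨D2, C, hC1, hC2⟩ := hT (max D1 0 + 3 * r) (by positivity)
  refine ⟨2 * max D1 0 + 2 * r + D2, fun i => B i ∪ C i, ?_, ?_⟩
  · rintro x (hx | hx)
    · obtain ⟨i, hi, h⟩ := hB1 x hx
      exact ⟨i, hi, Or.inl h⟩
    · obtain ⟨i, hi, h⟩ := hC1 x hx
      exact ⟨i, hi, Or.inr h⟩
  · intro i hi y
    rw [union_inter_distrib_right]
    exact chBdd_union hX hr ((hB2 i hi y).mono subset_rfl le_rfl (le_max_left _ _)) (hC2 i hi y)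

theorem QCov.iUnion {X Y : Type*} {dX : X → X → ℝ} {dY : Y → Y → ℝ} (hX : IsMetric dX)
    {f : X → Y} {n : ℕ} {R : ℝ} {ι : Type*} (s : Finset ι) (S : ι → Set X)
    (hS : ∀ j, QCov dX dY f n R (S j)) : QCov dX dY f n R (⋃ j ∈ s, S j) := by
  classical
  induction s using Finset.induction_on with
  | empty =>
    intro r hr
    refine ⟨0, fun _ => ∅, by simp, ?_⟩
    intro i _ y x z hxz
    rcases ReflTransGen.cases_head hxz with rfl | ⟨w, ⟨h, -, -⟩, -⟩
    · rw [(hX.2.1 x x).2 rfl]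
    · exact absurd h.1 (by simp)
  | insert a s _ ih =>
    rw [Finset.set_biUnion_insert]
    exact (hS a).union hX ih

theorem qCov_univ {X Y : Type*} {dX : X → X → ℝ} {dY : Y → Y → ℝ} (hX : IsMetric dX)
    (hY : IsMetric dY) {f : X → Y} {n m : ℕ}
    (hfib : ∀ r : ℝ, 0 < r → ASDimUnifLE dX (fun y : Y => f ⁻¹' {z | dY y z < r}) n)
    (hdim : ASDimLE dY univ m) (R : ℝ) : QCov dX dY f n R univ := by
  obtain ⟨T, hT, V, -, hcov, hbd, hdis⟩ := hdim (2 * max R 0 + 1) (by positivity)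
  have hmain : ∀ j, QCov dX dY f n R (f ⁻¹' (⋃₀ V j)) := by
    intro j r hr
    obtain ⟨D, hD, hfam⟩ := hfib (T + 1) (by positivity) r hr
    have hA : ∀ u : Set Y, ∃ A : ℕ → Set X, u ∈ V j →
        (∀ x, f x ∈ u → ∃ i < n + 1, x ∈ A i) ∧ ∀ i < n + 1, ChBdd dX (A i) r D := by
      intro u
      by_cases hu : u ∈ V j ∧ u.Nonempty
      · obtain ⟨hu, y, hy⟩ := hu
        obtain ⟨U, -, h2, h3, h4⟩ := hfam y
        refine ⟨fun i => if h : i < n + 1 then ⋃₀ U ⟨i, h⟩ else ∅, fun _ => ⟨?_, ?_⟩⟩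
        · intro x hx
          have : x ∈ ⋃ i, ⋃₀ U i := h2 (show dY y (f x) < T + 1 by
            linarith [hbd j u hu y hy _ hx])
          obtain ⟨i, hi⟩ := mem_iUnion.1 this
          exact ⟨i, i.2, by simpa [Nat.lt_succ_iff.1 i.2] using hi⟩
        · intro i hi
          simp only [hi, dif_pos]
          exact chBdd_sUnion hX hD (h3 _) (h4 _)
      · refine ⟨fun _ => ∅, fun h => ⟨fun x hx => absurd ⟨h, _, hx⟩ hu, ?_⟩⟩
        intro i _ x z hxz
        rcases ReflTransGen.cases_head hxz with rfl | ⟨w, ⟨h, -, -⟩, -⟩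
        · rw [(hX.2.1 x x).2 rfl]; exact hD.le
        · exact absurd h (by simp)
    choose A hA using hA
    refine ⟨D, fun i => {x | ∃ u ∈ V j, f x ∈ u ∧ x ∈ A u i}, ?_, ?_⟩
    · rintro x ⟨u, hu, hx⟩
      obtain ⟨i, hi, h⟩ := (hA u hu).1 x hx
      exact ⟨i, hi, u, hu, hx, h⟩
    · intro i hi y x z hxz
      rcases ReflTransGen.cases_head hxz with rfl | ⟨w, ⟨⟨⟨u, hu, hxu, hxA⟩, -⟩, -, -⟩, -⟩
      · rw [(hX.2.1 x x).2 rfl]; exact hD.le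
      · suffices ReflTransGen (ChStep dX (A u i) r) x z ∧ f z ∈ u ∧ z ∈ A u i from
          (hA u hu).2 i hi _ _ this.1
        clear w
        induction hxz with
        | refl => exact ⟨.refl, hxu, hxA⟩
        | @tail z w _ h ih =>
          obtain ⟨⟨-, hz⟩, ⟨⟨v, hv, hwv, hwA⟩, hw⟩, hlt⟩ := h
          have huv : u = v := by
            by_contra hne
            have h1 := hdis j u hu v hv hne _ ih.2.1 _ hwv
            have h2 := hY.2.2.2 (f z) y (f w)
            rw [hY.2.2.1 (f z) y] at h2
            simp only [mem_ofPred_eq] at hz hw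
            linarith [le_max_left R 0]
          subst huv
          exact ⟨ih.1.tail ⟨ih.2.2, hwA, hlt⟩, hwv, hwA⟩
  have := QCov.iUnion hX Finset.univ _ hmain
  intro r hr
  obtain ⟨D, B, h1, h2⟩ := this r hr
  refine ⟨D, B, fun x _ => h1 x ?_, h2⟩
  obtain ⟨j, hj⟩ := mem_iUnion.1 (hcov (mem_univ (f x)))
  simp only [mem_iUnion]
  exact ⟨j, Finset.mem_univ _, hj⟩

open Classical in
/-- `(n,k)`-dimensional control for a function. -/
def PCtl {X Z : Type*} (dX : X → X → ℝ) (dZ : Z → Z → ℝ) (f : X → Z) (n k : ℕ) : Prop :=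
  ∀ r : ℝ, 0 < r → ∀ R : ℝ, ∃ D : ℝ, ∃ B : ℕ → Set X,
    (∀ x, k ≤ ((Finset.range k).filter (fun i => x ∈ B i)).card + n) ∧
    ∀ i < k, ∀ y : Z, ChBdd dX (B i ∩ {x | dZ y (f x) ≤ R}) r D

theorem pCtl_base {X Z : Type*} {dX : X → X → ℝ} {dZ : Z → Z → ℝ} {f : X → Z} {n : ℕ}
    (h : ∀ R, QCov dX dZ f n R univ) : PCtl dX dZ f n (n + 1) := by
  classical
  intro r hr R
  obtain ⟨D, B, h1, h2⟩ := h R r hr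
  refine ⟨D, B, fun x => ?_, h2⟩
  obtain ⟨i, hi, hx⟩ := h1 x (mem_univ _)
  have : 0 < ((Finset.range (n + 1)).filter (fun i => x ∈ B i)).card :=
    Finset.card_pos.2 ⟨i, by simp [hx]; omega⟩
  convert (show n + 1 ≤ ((Finset.range (n + 1)).filter (fun i => x ∈ B i)).card + n by omega)

open Classical in
theorem pCtl_step {X Z : Type*} {dX : X → X → ℝ} {dZ : Z → Z → ℝ} (hX : IsMetric dX)
    (hZ : IsMetric dZ) {f : X → Z} {K : ℝ} (hK : 0 ≤ K)
    (hlip : ∀ x x', dZ (f x) (f x') ≤ K * dX x x') {n k : ℕ} (hk : n + 1 ≤ k)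
    (h : PCtl dX dZ f n k) : PCtl dX dZ f n (k + 1) := by
  intro r hr R
  obtain ⟨D, B, hc, hB⟩ := h (3 * r) (by positivity) (R + K * r)
  obtain ⟨hnn, hz, hsymm, htri⟩ := hX
  set B' : ℕ → Set X := fun i => {x | ∃ b ∈ B i, dX x b < r} with hB'
  set S : X → Finset ℕ := fun x => (Finset.range k).filter (fun i => x ∈ B i) with hS
  set S' : X → Finset ℕ := fun x => (Finset.range k).filter (fun i => x ∈ B' i) with hS'
  have hSS : ∀ x, S x ⊆ S' x := by
    intro x i hi
    simp only [hS, hS', Finset.mem_filter] at hi ⊢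
    exact ⟨hi.1, x, hi.2, by rw [(hz x x).2 rfl]; exact hr⟩
  have hcS : ∀ x, k ≤ (S x).card + n := hc
  refine ⟨D + 2 * r, fun i => if i < k then B' i else {x | (S' x).card + n ≤ k}, ?_, ?_⟩
  · intro x
    have e : (Finset.range (k + 1)).filter
        (fun i => x ∈ (if i < k then B' i else {x | (S' x).card + n ≤ k})) =
        if (S' x).card + n ≤ k then insert k (S' x) else S' x := by
      ext i
      split_ifs with h1
      · simp only [Finset.mem_filter, Finset.mem_range, Finset.mem_insert, hS']
        by_cases hik : i < k
        · simp only [hik, if_true]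
          constructor
          · rintro ⟨_, h⟩; exact Or.inr ⟨trivial, h⟩
          · rintro (h | ⟨_, h⟩)
            · omega
            · exact ⟨by omega, h⟩
        · simp only [hik, if_false, false_and, or_false]
          constructor
          · rintro ⟨h, -⟩; omega
          · rintro rfl; exact ⟨by omega, h1⟩
      · simp only [Finset.mem_filter, Finset.mem_range, hS']
        by_cases hik : i < k
        · simp only [hik, if_true]
          constructor
          · rintro ⟨_, h⟩; exact ⟨trivial, h⟩
          · rintro ⟨_, h⟩; exact ⟨by omega, h⟩
        · simp only [hik, if_false, false_and, iff_false]
          rintro ⟨_, h⟩; exact h1 h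
    rw [e]
    have h2 := Finset.card_le_card (hSS x)
    have h3 := hcS x
    split_ifs with h1
    · rw [Finset.card_insert_of_notMem (by simp [hS'])]
      omega
    · omega
  · intro i hi y x z hxz
    have hDnn : 0 ≤ D := by
      have := hB 0 (by omega) y x x .refl
      rwa [(hz x x).2 rfl] at this
    by_cases hik : i < k
    · simp only [hik, if_true] at hxz
      rcases ReflTransGen.cases_head hxz with rfl | ⟨w, ⟨⟨⟨b0, hb0, hxb⟩, hxy⟩, -, -⟩, -⟩
      · rw [(hz x x).2 rfl]; linarith
      · have hin : ∀ w b, dZ y (f w) ≤ R → dX w b < r → dZ y (f b) ≤ R + K * r := by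
          intro w b h1 h2
          have := mul_le_mul_of_nonneg_left h2.le hK
          linarith [hZ.2.2.2 y (f w) (f b), hlip w b]
        suffices ∃ b ∈ B i, dX z b < r ∧ dZ y (f b) ≤ R + K * r ∧ ReflTransGen
            (ChStep dX (B i ∩ {x | dZ y (f x) ≤ R + K * r}) (3 * r)) b0 b by
          obtain ⟨b, hb, h1, -, h2⟩ := this
          have := hB i hik y _ _ h2
          have h3 := hsymm z b
          linarith [htri x b0 b, htri x b z]
        clear w
        induction hxz with
        | refl => exact ⟨b0, hb0, hxb, hin _ _ hxy hxb, .refl⟩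
        | @tail z w _ h ih =>
          obtain ⟨-, ⟨⟨c, hcB, hwc⟩, hwy⟩, hlt⟩ := h
          obtain ⟨b, hb, h1, h2, h3⟩ := ih
          refine ⟨c, hcB, hwc, hin _ _ hwy hwc, h3.tail ⟨⟨hb, h2⟩, ⟨hcB, hin _ _ hwy hwc⟩, ?_⟩⟩
          linarith [htri b z c, htri z w c, hsymm b z]
    · simp only [hik, if_false] at hxz
      rcases ReflTransGen.cases_head hxz with rfl | ⟨w, ⟨⟨hx, hxy⟩, -, -⟩, -⟩
      · rw [(hz x x).2 rfl]; linarith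
      · have hpos : 0 < (S x).card := by have := hcS x; omega
        obtain ⟨j, hj⟩ := Finset.card_pos.1 hpos
        have hjk : j < k := by
          simp only [hS, Finset.mem_filter, Finset.mem_range] at hj; exact hj.1
        have hmem : ∀ w, S w = S x → w ∈ B j := by
          intro w hw
          rw [← hw] at hj
          simp only [hS, Finset.mem_filter] at hj; exact hj.2
        have hKr : 0 ≤ K * r := by positivity
        suffices S z = S x ∧ ReflTransGen
            (ChStep dX (B j ∩ {x | dZ y (f x) ≤ R + K * r}) (3 * r)) x z by
          have := hB j hjk y _ _ this.2
          linarith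
        clear w
        induction hxz with
        | refl => exact ⟨rfl, .refl⟩
        | @tail z w _ h ih =>
          obtain ⟨⟨hz1, hz2⟩, ⟨hw1, hw2⟩, hlt⟩ := h
          simp only [mem_ofPred_eq] at hz1 hz2 hw1 hw2
          have h1 : S z ⊆ S' w := by
            intro i hi
            simp only [hS, hS', Finset.mem_filter] at hi ⊢
            exact ⟨hi.1, z, hi.2, by rw [hsymm]; exact hlt⟩
          have h2 : S z = S' w := Finset.eq_of_subset_of_card_le h1 (by have := hcS z; omega)
          have h3 : S w = S' w := Finset.eq_of_subset_of_card_le (hSS w)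
            (by have := hcS w; omega)
          have h4 : S w = S x := by rw [h3, ← h2, ih.1]
          refine ⟨h4, ih.2.tail ⟨⟨hmem _ ih.1, ?_⟩, ⟨hmem _ h4, ?_⟩, by linarith⟩⟩
          · simp only [mem_ofPred_eq]; linarith
          · simp only [mem_ofPred_eq]; linarith

theorem pCtl_all {X Z : Type*} {dX : X → X → ℝ} {dZ : Z → Z → ℝ} (hX : IsMetric dX)
    (hZ : IsMetric dZ) {f : X → Z} {K : ℝ} (hK : 0 ≤ K)
    (hlip : ∀ x x', dZ (f x) (f x') ≤ K * dX x x') {n : ℕ}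
    (h : ∀ R, QCov dX dZ f n R univ) (k : ℕ) (hk : n + 1 ≤ k) : PCtl dX dZ f n k := by
  induction k, hk using Nat.le_induction with
  | base => exact pCtl_base h
  | succ k hk ih => exact pCtl_step hX hZ hK hlip hk ih

theorem qCov_const {Y : Type*} {dY : Y → Y → ℝ} (hY : IsMetric dY) {m : ℕ}
    (hdim : ASDimLE dY univ m) (R : ℝ) :
    QCov dY (fun _ _ : Unit => (0 : ℝ)) (fun _ => ()) m R univ := by
  intro r hr
  obtain ⟨D, hD, U, -, h2, h3, h4⟩ := hdim r hr
  refine ⟨D, fun i => if h : i < m + 1 then ⋃₀ U ⟨i, h⟩ else ∅, ?_, ?_⟩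
  · intro x hx
    obtain ⟨i, hi⟩ := mem_iUnion.1 (h2 hx)
    exact ⟨i, i.2, by simpa [Nat.lt_succ_iff.1 i.2] using hi⟩
  · intro i hi _
    simp only [hi, dif_pos]
    exact (chBdd_sUnion hY hD (h3 _) (h4 _)).mono inter_subset_left le_rfl le_rfl

theorem asdimLE_of_chBdd {X : Type*} {d : X → X → ℝ} (hd : IsMetric d) {N : ℕ}
    (h : ∀ r : ℝ, 0 < r → ∃ D : ℝ, ∃ A : ℕ → Set X, (∀ x, ∃ i < N + 1, x ∈ A i) ∧
      ∀ i < N + 1, ChBdd d (A i) r D) : ASDimLE d univ N := by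
  intro r hr
  obtain ⟨D, A, h1, h2⟩ := h r hr
  have hsym : ∀ i x y, ReflTransGen (ChStep d (A i) r) x y →
      ReflTransGen (ChStep d (A i) r) y x := by
    intro i x y hxy
    induction hxy with
    | refl => exact .refl
    | tail _ h ih => exact .head ⟨h.2.1, h.1, by rw [hd.2.2.1]; exact h.2.2⟩ ih
  refine ⟨max D 1, by positivity, fun i => {u | ∃ x ∈ A i, u = {y | y ∈ A i ∧
    ReflTransGen (ChStep d (A i) r) x y}}, fun _ _ _ => subset_univ _, ?_, ?_, ?_⟩
  · intro x _
    obtain ⟨i, hi, hx⟩ := h1 x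
    exact mem_iUnion.2 ⟨⟨i, hi⟩, _, ⟨x, hx, rfl⟩, hx, .refl⟩
  · rintro i _ ⟨a, ha, rfl⟩ x ⟨_, hx⟩ y ⟨_, hy⟩
    exact (h2 i i.2 _ _ ((hsym _ _ _ hx).trans hy)).trans (le_max_left _ _)
  · rintro i _ ⟨a, ha, rfl⟩ _ ⟨b, hb, rfl⟩ hne x ⟨hxA, hx⟩ y ⟨hyA, hy⟩
    by_contra hlt
    rw [not_le] at hlt
    have hab : ReflTransGen (ChStep d (A i) r) a b :=
      (hx.tail ⟨hxA, hyA, hlt⟩).trans (hsym _ _ _ hy)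
    apply hne
    ext w
    constructor
    · rintro ⟨hw, h⟩; exact ⟨hw, (hsym _ _ _ hab).trans h⟩
    · rintro ⟨hw, h⟩; exact ⟨hw, hab.trans h⟩

theorem hurewicz_aux {X Y : Type*} {dX : X → X → ℝ} {dY : Y → Y → ℝ} (hX : IsMetric dX)
    (hY : IsMetric dY) {f : X → Y} {K : ℝ} (hK : 0 ≤ K)
    (hlip : ∀ x x', dY (f x) (f x') ≤ K * dX x x') {n m : ℕ}
    (hfib : ∀ r : ℝ, 0 < r → ASDimUnifLE dX (fun y : Y => f ⁻¹' {z | dY y z < r}) n)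
    (hdim : ASDimLE dY univ m) : ASDimLE dX univ (m + n) := by
  classical
  have hU : IsMetric (fun _ _ : Unit => (0 : ℝ)) := by
    refine ⟨by simp, by simp, by simp, by simp⟩
  have hPY := pCtl_all hY hU le_rfl (K := 0) (by simp) (qCov_const hY hdim) (m + n + 1) (by omega)
  have hPX := pCtl_all hX hY hK hlip (qCov_univ hX hY hfib hdim) (m + n + 1) (by omega)
  apply asdimLE_of_chBdd hX
  intro r hr
  obtain ⟨T, C, hC1, hC2⟩ := hPY (K * r + 1) (by positivity) 0
  obtain ⟨D, B, hB1, hB2⟩ := hPX r hr T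
  refine ⟨D, fun i => B i ∩ f ⁻¹' C i, ?_, ?_⟩
  · intro x
    have h1 := hC1 (f x)
    have h2 := hB1 x
    by_contra! hno
    have hdisj : Disjoint ((Finset.range (m + n + 1)).filter (fun i => f x ∈ C i))
        ((Finset.range (m + n + 1)).filter (fun i => x ∈ B i)) := by
      rw [Finset.disjoint_left]
      intro i hi hj
      simp only [Finset.mem_filter, Finset.mem_range] at hi hj
      exact hno i hi.1 ⟨hj.2, hi.2⟩
    have h3 := Finset.card_le_card (Finset.union_subset
      (Finset.filter_subset (fun i => f x ∈ C i) (Finset.range (m + n + 1)))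
      (Finset.filter_subset (fun i => x ∈ B i) (Finset.range (m + n + 1))))
    rw [Finset.card_union_of_disjoint hdisj, Finset.card_range] at h3
    have e1 : ∀ (p : ℕ → Prop) (i1 i2 : DecidablePred p) (s : Finset ℕ),
      (@Finset.filter _ p i1 s).card = (@Finset.filter _ p i2 s).card := by
        intros; congr!
    omega
  · intro i hi x z hxz
    have hT : ∀ z, ReflTransGen (ChStep dX (B i ∩ f ⁻¹' C i) r) x z → dY (f x) (f z) ≤ T := by
      intro z hz
      apply hC2 i hi () (f x) (f z)
      refine ReflTransGen.lift f ?_ _ _ hz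
      rintro a b ⟨ha, hb, hlt⟩
      refine ⟨⟨ha.2, by simp⟩, ⟨hb.2, by simp⟩, ?_⟩
      have := mul_le_mul_of_nonneg_left hlt.le hK
      linarith [hlip a b]
    apply hB2 i hi (f x)
    induction hxz with
    | refl => exact .refl
    | @tail z w hxz h ih =>
      exact ih.tail ⟨⟨h.1.1, hT _ hxz⟩, ⟨h.2.1.1, hT _ (hxz.tail h)⟩, h.2.2⟩

end Helpers

/-- asymptotic Hurewicz mapping theorem for Lipschitz maps from a geodesic
metric space: if the collections of preimages of `r`-balls have asymptotic dimension
uniformly bounded by `n` for all `r > 0`, then `asdim X ≤ asdim Y + n`. -/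
theorem hurewicz_of_lipschitz_geodesic
    {X Y : Type*} (dX : X → X → ℝ) (dY : Y → Y → ℝ)
    (hX : IsMetric dX) (hY : IsMetric dY)
    (hgeo : ∀ x y : X, ∃ γ : ℝ → X, γ 0 = x ∧ γ (dX x y) = y ∧
      ∀ s ∈ Icc (0 : ℝ) (dX x y), ∀ t ∈ Icc (0 : ℝ) (dX x y), dX (γ s) (γ t) = |s - t|)
    (f : X → Y)
    (hlip : ∃ K : ℝ, 0 ≤ K ∧ ∀ x x' : X, dY (f x) (f x') ≤ K * dX x x') (n : ℕ)
    (hfib : ∀ r : ℝ, 0 < r → ASDimUnifLE dX (fun y : Y => f ⁻¹' {z | dY y z < r}) n) :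
    asdim dX (univ : Set X) ≤ asdim dY (univ : Set Y) + (n : ℕ∞) := by
  obtain ⟨K, hK, hlip⟩ := hlip
  by_cases hne : {m | ASDimLE dY univ m}.Nonempty
  · have hmem := csInf_mem (hne.image (fun n : ℕ => (n : ℕ∞)))
    obtain ⟨m, hm, he⟩ := hmem
    have he' : asdim dY univ = (m : ℕ∞) := he.symm
    rw [he']
    refine sInf_le ⟨m + n, hurewicz_aux hX hY hK hlip hfib hm, ?_⟩
    push_cast
    rfl
  · have : asdim dY univ = ⊤ := by
      rw [asdim, not_nonempty_iff_eq_empty.1 hne, image_empty, sInf_empty]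
    rw [this]
    simp
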